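/- There exists a subgroup of SL(3,ℤ) of finite index generated by two elements. More generally, for every n ≥ 3, SL(n,ℤ) itself contains a finite-index subgroup generated by two elements, one of which may be taken to be a power of a single fixed unipotent element. -/

import Mathlib

namespace SLFiniteIndex

open Matrix
open scoped commutatorElement

variable {ι : Type*} [Fintype ι] [DecidableEq ι]

/-- The transvection `1 + v wᵀ`, for `w ⬝ᵥ v = 0`, as an element of `SL(ι, ℤ)`. -/
def tv (v w : ι → ℤ) (h : w ⬝ᵥ v = 0) : SpecialLinearGroup ι ℤ :=
  ⟨1 + vecMulVec v w, by
    rw [vecMulVec_eq Unit, det_one_add_replicateCol_mul_replicateRow, h, add_zero]⟩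

@[simp]
theorem coe_tv (v w : ι → ℤ) (h : w ⬝ᵥ v = 0) :
    (tv v w h : Matrix ι ι ℤ) = 1 + vecMulVec v w := rfl

theorem coe_injective {A B : SpecialLinearGroup ι ℤ} (h : (A : Matrix ι ι ℤ) = B) : A = B :=
  Subtype.ext h

theorem tv_congr {v w v' w' : ι → ℤ} (h : w ⬝ᵥ v = 0) (h' : w' ⬝ᵥ v' = 0)
    (e : vecMulVec v w = vecMulVec v' w') : tv v w h = tv v' w' h' :=
  coe_injective (by rw [coe_tv, coe_tv, e])

theorem tv_mul_tv_right {v w w' : ι → ℤ} (h : w ⬝ᵥ v = 0) (h' : w' ⬝ᵥ v = 0) :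
    tv v w h * tv v w' h' = tv v (w + w') (by rw [add_dotProduct, h, h', add_zero]) := by
  apply coe_injective
  simp only [Matrix.SpecialLinearGroup.coe_mul, coe_tv, mul_add, add_mul, one_mul, mul_one,
    vecMulVec_mul_vecMulVec, vecMulVec_add, h, zero_smul, vecMulVec_zero]
  abel

theorem tv_mul_tv_left {v v' w : ι → ℤ} (h : w ⬝ᵥ v = 0) (h' : w ⬝ᵥ v' = 0) :
    tv v w h * tv v' w h' = tv (v + v') w (by rw [dotProduct_add, h, h', add_zero]) := by
  apply coe_injective
  simp only [Matrix.SpecialLinearGroup.coe_mul, coe_tv, mul_add, add_mul, one_mul, mul_one,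
    vecMulVec_mul_vecMulVec, add_vecMulVec, h', zero_smul, vecMulVec_zero]
  abel

theorem tv_zero_right (v : ι → ℤ) : tv v 0 (zero_dotProduct v) = 1 :=
  coe_injective (by simp)

theorem tv_zero_left (w : ι → ℤ) : tv 0 w (dotProduct_zero w) = 1 :=
  coe_injective (by simp)

theorem tv_inv {v w : ι → ℤ} (h : w ⬝ᵥ v = 0) :
    (tv v w h)⁻¹ = tv v (-w) (by rw [neg_dotProduct, h, neg_zero]) := by
  rw [inv_eq_iff_mul_eq_one, tv_mul_tv_right]
  exact coe_injective (by simp)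

theorem tv_commutator {v x y w : ι → ℤ} (hxv : x ⬝ᵥ v = 0) (hwy : w ⬝ᵥ y = 0) (hxy : x ⬝ᵥ y = 1)
    (hwv : w ⬝ᵥ v = 0) : ⁅tv v x hxv, tv y w hwy⁆ = tv v w hwv := by
  rw [commutatorElement_def, mul_inv_eq_iff_eq_mul, mul_inv_eq_iff_eq_mul]
  apply coe_injective
  simp only [Matrix.SpecialLinearGroup.coe_mul, coe_tv, mul_add, add_mul, one_mul, mul_one,
    vecMulVec_mul_vecMulVec, hwv, hwy, hxy, zero_smul, vecMulVec_zero, one_smul,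
    add_zero]
  abel

theorem dotProduct_conj (g : SpecialLinearGroup ι ℤ) (v w : ι → ℤ) :
    (w ᵥ* ((g⁻¹ : SpecialLinearGroup ι ℤ) : Matrix ι ι ℤ)) ⬝ᵥ ((g : Matrix ι ι ℤ) *ᵥ v)
      = w ⬝ᵥ v := by
  rw [← dotProduct_mulVec, mulVec_mulVec, ← Matrix.SpecialLinearGroup.coe_mul, inv_mul_cancel,
    Matrix.SpecialLinearGroup.coe_one, one_mulVec]

theorem conj_tv (g : SpecialLinearGroup ι ℤ) {v w : ι → ℤ} (h : w ⬝ᵥ v = 0) :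
    g * tv v w h * g⁻¹ = tv ((g : Matrix ι ι ℤ) *ᵥ v)
      (w ᵥ* ((g⁻¹ : SpecialLinearGroup ι ℤ) : Matrix ι ι ℤ))
      ((dotProduct_conj g v w).trans h) := by
  rw [mul_inv_eq_iff_eq_mul]
  apply coe_injective
  rw [Matrix.SpecialLinearGroup.coe_mul, Matrix.SpecialLinearGroup.coe_mul, coe_tv, coe_tv,
    mul_add, add_mul, mul_vecMulVec, vecMulVec_mul, vecMul_vecMul,
    ← Matrix.SpecialLinearGroup.coe_mul, inv_mul_cancel, Matrix.SpecialLinearGroup.coe_one,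
    vecMul_one, mul_one, one_mul]

/-- The subgroup `H` contains the transvection `1 + v wᵀ`. -/
def HasTv (H : Subgroup (SpecialLinearGroup ι ℤ)) (v w : ι → ℤ) : Prop :=
  ∃ h : w ⬝ᵥ v = 0, tv v w h ∈ H

namespace HasTv

variable {H : Subgroup (SpecialLinearGroup ι ℤ)} {v v' w w' x y : ι → ℤ}

theorem congr (hH : HasTv H v w) (h : w' ⬝ᵥ v' = 0) (e : vecMulVec v w = vecMulVec v' w') :
    HasTv H v' w' :=
  ⟨h, tv_congr hH.1 h e ▸ hH.2⟩

theorem smul_left_iff (c : ℤ) : HasTv H (c • v) w ↔ HasTv H v (c • w) := by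
  have e : vecMulVec (c • v) w = vecMulVec v (c • w) := by rw [smul_vecMulVec, vecMulVec_smul]
  constructor
  · intro h
    exact h.congr (by rw [smul_dotProduct, ← dotProduct_smul]; exact h.1) e
  · intro h
    exact h.congr (by rw [dotProduct_smul, ← smul_dotProduct]; exact h.1) e.symm

theorem zero_right : HasTv H v 0 :=
  ⟨zero_dotProduct v, by rw [tv_zero_right]; exact H.one_mem⟩

theorem zero_left : HasTv H 0 w :=
  ⟨dotProduct_zero w, by rw [tv_zero_left]; exact H.one_mem⟩

theorem add_right (h : HasTv H v w) (h' : HasTv H v w') : HasTv H v (w + w') :=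
  ⟨_, tv_mul_tv_right h.1 h'.1 ▸ H.mul_mem h.2 h'.2⟩

theorem add_left (h : HasTv H v w) (h' : HasTv H v' w) : HasTv H (v + v') w :=
  ⟨_, tv_mul_tv_left h.1 h'.1 ▸ H.mul_mem h.2 h'.2⟩

theorem neg_right (h : HasTv H v w) : HasTv H v (-w) :=
  ⟨_, tv_inv h.1 ▸ H.inv_mem h.2⟩

theorem sum_right {κ : Type*} {s : Finset κ} {f : κ → ι → ℤ} (h : ∀ k ∈ s, HasTv H v (f k)) :
    HasTv H v (∑ k ∈ s, f k) :=
  Finset.sum_induction f (HasTv H v) (fun _ _ => add_right) zero_right h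

theorem sum_left {κ : Type*} {s : Finset κ} {f : κ → ι → ℤ} (h : ∀ k ∈ s, HasTv H (f k) w) :
    HasTv H (∑ k ∈ s, f k) w :=
  Finset.sum_induction f (HasTv H · w) (fun _ _ => add_left) zero_left h

theorem smul_right (h : HasTv H v w) (c : ℤ) : HasTv H v (c • w) := by
  induction c with
  | zero => rw [zero_smul]; exact zero_right
  | succ n ih => rw [add_smul, one_smul]; exact ih.add_right h
  | pred n ih => rw [sub_smul, one_smul, sub_eq_add_neg]; exact ih.add_right h.neg_right

theorem commutator (h : HasTv H v x) (h' : HasTv H y w) (hxy : x ⬝ᵥ y = 1) (hwv : w ⬝ᵥ v = 0) :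
    HasTv H v w :=
  ⟨hwv, tv_commutator h.1 h'.1 hxy hwv ▸ by
    exact H.mul_mem (H.mul_mem (H.mul_mem h.2 h'.2) (H.inv_mem h.2)) (H.inv_mem h'.2)⟩

end HasTv

/-- The standard basis vector. -/
abbrev e (i : ι) : ι → ℤ := Pi.single i 1

/-- The subgroup `H` contains all elementary matrices with off-diagonal entry `q`. -/
def HasLevel (H : Subgroup (SpecialLinearGroup ι ℤ)) (q : ℤ) : Prop :=
  ∀ i j : ι, i ≠ j → HasTv H (e i) (q • e j)

namespace HasLevel

variable {H : Subgroup (SpecialLinearGroup ι ℤ)} {q : ℤ}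

theorem elementary (hH : HasLevel H q) {i j : ι} (hij : i ≠ j) {c : ℤ} (hc : q ∣ c) :
    HasTv H (e i) (c • e j) := by
  obtain ⟨d, rfl⟩ := hc
  rw [mul_comm, mul_smul]
  exact (hH i j hij).smul_right d

theorem column (hH : HasLevel H q) {k : ι} {v : ι → ℤ} (hk : v k = 0) (hv : ∀ i, q ∣ v i) :
    HasTv H v (e k) := by
  rw [pi_eq_sum_univ' v]
  refine HasTv.sum_left fun i _ => ?_
  by_cases h : i = k
  · rw [h, hk, zero_smul]; exact HasTv.zero_left
  · exact (HasTv.smul_left_iff _).2 (hH.elementary h (hv i))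

theorem row (hH : HasLevel H q) {k : ι} {w : ι → ℤ} (hk : w k = 0) (hw : ∀ i, q ∣ w i) :
    HasTv H (e k) w := by
  rw [pi_eq_sum_univ' w]
  refine HasTv.sum_right fun i _ => ?_
  by_cases h : i = k
  · rw [h, hk, zero_smul]; exact HasTv.zero_right
  · exact hH.elementary (Ne.symm h) (hw i)

theorem of_apply_eq_zero (hH : HasLevel H q) {k : ι} {v w : ι → ℤ} (hk : w k = 0)
    (hwv : w ⬝ᵥ v = 0) {c : ℤ} (hc : q ^ 2 ∣ c) : HasTv H v (c • w) := by
  obtain ⟨d, rfl⟩ := hc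
  rw [mul_comm, mul_smul]
  refine HasTv.smul_right ?_ d
  have hwk : w ⬝ᵥ (v k • e k) = 0 := by rw [dotProduct_smul, dotProduct_single_one, hk, smul_zero]
  have hwv' : w ⬝ᵥ (v - v k • e k) = 0 := by rw [dotProduct_sub, hwv, hwk, sub_zero]
  have h1 : HasTv H (v - v k • e k) (q ^ 2 • w) := by
    rw [pow_two, mul_smul, ← HasTv.smul_left_iff]
    refine HasTv.commutator (x := e k) (y := e k) (hH.column (by simp) fun i => ?_)
      (hH.row (by simp [hk]) fun i => ?_) (by simp) (by
        rw [dotProduct_smul, smul_dotProduct, hwv', smul_zero, smul_zero])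
    · exact ⟨_, by simp only [Pi.smul_apply, smul_eq_mul]; rfl⟩
    · exact ⟨_, by simp only [Pi.smul_apply, smul_eq_mul]; rfl⟩
  have h2 : HasTv H (v k • e k) (q ^ 2 • w) := by
    rw [HasTv.smul_left_iff]
    refine hH.row (by simp [hk]) fun i => ?_
    exact ⟨v k * q * w i, by simp only [Pi.smul_apply, smul_eq_mul]; ring⟩
  simpa using h1.add_left h2

/-- The row vector `v b • e a - v a • e b`, which annihilates `v`. -/
def koszul (v : ι → ℤ) (a b : ι) : ι → ℤ := v b • e a - v a • e b

theorem koszul_dotProduct (v : ι → ℤ) (a b : ι) : koszul v a b ⬝ᵥ v = 0 := by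
  rw [koszul, sub_dotProduct, smul_dotProduct, smul_dotProduct, single_one_dotProduct,
    single_one_dotProduct, smul_eq_mul, smul_eq_mul, mul_comm, sub_self]

theorem sum_koszul {v w y : ι → ℤ} (hyv : y ⬝ᵥ v = 1) (hwv : w ⬝ᵥ v = 0) :
    ∑ a, ∑ b, (w a * y b) • koszul v a b = w := by
  have h1 : ∑ b, y b * v b = 1 := hyv
  have h2 : ∑ a, w a * v a = 0 := hwv
  have h3 : ∀ a b, (w a * y b) • koszul v a b
      = (y b * v b) • (w a • e a) - (w a * v a) • (y b • e b) := by
    intro a b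
    ext i
    simp only [koszul, Pi.smul_apply, Pi.sub_apply, smul_eq_mul]
    ring
  simp only [h3, Finset.sum_sub_distrib, ← Finset.sum_smul, ← Finset.smul_sum, h1, h2, one_smul,
    zero_smul, sub_zero]
  exact (pi_eq_sum_univ' w).symm

theorem koszul_mem (h3 : ∀ a b : ι, ∃ k, k ≠ a ∧ k ≠ b) (hH : HasLevel H q) (v : ι → ℤ) (a b : ι)
    {c : ℤ} (hc : q ^ 2 ∣ c) : HasTv H v (c • koszul v a b) := by
  obtain ⟨k, hka, hkb⟩ := h3 a b
  exact hH.of_apply_eq_zero (k := k) (by simp [koszul, hka, hkb]) (koszul_dotProduct v a b) hc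

theorem unimodular (h3 : ∀ a b : ι, ∃ k, k ≠ a ∧ k ≠ b) (hH : HasLevel H q) {v w y : ι → ℤ}
    (hyv : y ⬝ᵥ v = 1) (hwv : w ⬝ᵥ v = 0) : HasTv H v (q ^ 2 • w) := by
  rw [← sum_koszul hyv hwv, Finset.smul_sum]
  refine HasTv.sum_right fun a _ => ?_
  rw [Finset.smul_sum]
  refine HasTv.sum_right fun b _ => ?_
  rw [smul_smul]
  exact koszul_mem h3 hH v a b (dvd_mul_right _ _)

end HasLevel

theorem HasLevel.normalCore (h3 : ∀ a b : ι, ∃ k, k ≠ a ∧ k ≠ b)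
    {H : Subgroup (SpecialLinearGroup ι ℤ)} {q : ℤ} (hH : HasLevel H q) :
    HasLevel H.normalCore (q ^ 2) := by
  intro i j hij
  have hd : (q ^ 2 • e j) ⬝ᵥ e i = 0 := by
    simp [hij, -zsmul_eq_mul]
  refine ⟨hd, fun g => ?_⟩
  rw [conj_tv]
  have h := hH.unimodular h3 (v := (g : Matrix ι ι ℤ) *ᵥ e i)
    (w := e j ᵥ* ((g⁻¹ : SpecialLinearGroup ι ℤ) : Matrix ι ι ℤ))
    (y := e i ᵥ* ((g⁻¹ : SpecialLinearGroup ι ℤ) : Matrix ι ι ℤ))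
    (by rw [dotProduct_conj]; simp) (by rw [dotProduct_conj]; simp [hij])
  simp only [smul_vecMul]
  exact h.2

omit [Fintype ι] in
theorem e_apply (i a : ι) : e i a = (1 : Matrix ι ι ℤ) a i := by
  simp [Pi.single_apply, one_apply]

omit [Fintype ι] in
theorem e_apply' (i a : ι) : e i a = (1 : Matrix ι ι ℤ) i a := by
  rw [e_apply, one_apply, one_apply]
  simp only [eq_comm]

section Quotient

variable {N : Subgroup (SpecialLinearGroup ι ℤ)} [N.Normal]

theorem mk_tv_right {v w w' : ι → ℤ} (h : w ⬝ᵥ v = 0) (h' : w' ⬝ᵥ v = 0) (hN : HasTv N v (w - w')) :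
    QuotientGroup.mk' N (tv v w h) = QuotientGroup.mk' N (tv v w' h') := by
  have key : tv v w h = tv v w' h' * tv v (w - w') hN.1 := by
    rw [tv_mul_tv_right]
    exact tv_congr _ _ (by rw [add_sub_cancel])
  rw [key, map_mul, QuotientGroup.mk'_apply N (tv _ _ hN.1), (QuotientGroup.eq_one_iff _).2 hN.2,
    mul_one]

theorem mk_tv_left {v v' w : ι → ℤ} (h : w ⬝ᵥ v = 0) (h' : w ⬝ᵥ v' = 0) (hN : HasTv N (v - v') w) :
    QuotientGroup.mk' N (tv v w h) = QuotientGroup.mk' N (tv v' w h') := by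
  have key : tv v w h = tv v' w h' * tv (v - v') w hN.1 := by
    rw [tv_mul_tv_left]
    exact tv_congr _ _ (by rw [add_sub_cancel])
  rw [key, map_mul, QuotientGroup.mk'_apply N (tv _ _ hN.1), (QuotientGroup.eq_one_iff _).2 hN.2,
    mul_one]

theorem mk_conj_elementary (h3 : ∀ a b : ι, ∃ k, k ≠ a ∧ k ≠ b) {q : ℤ} (hN : HasLevel N q)
    {A : SpecialLinearGroup ι ℤ} (hA : ∀ a b, q ^ 2 ∣ A a b - (1 : Matrix ι ι ℤ) a b)
    (hA' : ∀ a b, q ^ 2 ∣ A⁻¹ a b - (1 : Matrix ι ι ℤ) a b) {i j : ι} (hij : i ≠ j)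
    (hd : e j ⬝ᵥ e i = 0) :
    QuotientGroup.mk' N (A * tv (e i) (e j) hd * A⁻¹) =
      QuotientGroup.mk' N (tv (e i) (e j) hd) := by
  obtain ⟨k, hki, hkj⟩ := h3 i j
  rw [conj_tv]
  have hq : q ∣ q ^ 2 := dvd_pow_self q two_ne_zero
  set v := (A : Matrix ι ι ℤ) *ᵥ e i with hv
  set w := e j ᵥ* ((A⁻¹ : SpecialLinearGroup ι ℤ) : Matrix ι ι ℤ) with hw
  set y := e i ᵥ* ((A⁻¹ : SpecialLinearGroup ι ℤ) : Matrix ι ι ℤ) with hy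
  have hwv : w ⬝ᵥ v = 0 := by rw [hw, hv, dotProduct_conj, hd]
  have hyv : y ⬝ᵥ v = 1 := by rw [hy, hv, dotProduct_conj]; simp
  have dv : ∀ a, q ^ 2 ∣ v a - e i a := fun a => by
    have := hA a i
    rwa [hv, mulVec_single_one, col_apply, e_apply]
  have dw : ∀ a, q ^ 2 ∣ w a - e j a := fun a => by
    have := hA' j a
    rwa [hw, single_one_vecMul, row_apply, e_apply']
  have dy : ∀ a, q ^ 2 ∣ y a - e i a := fun a => by
    have := hA' i a
    rwa [hy, single_one_vecMul, row_apply, e_apply']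
  set w₀ := HasLevel.koszul v j i with hw₀
  have hw₀v : w₀ ⬝ᵥ v = 0 := HasLevel.koszul_dotProduct v j i
  have hw₀k : w₀ k = 0 := by simp [hw₀, HasLevel.koszul, hki, hkj]
  have dw₀ : ∀ a, q ^ 2 ∣ w₀ a - e j a := fun a => by
    have h1 := (dv i).mul_right (e j a)
    have h2 := (dv j).mul_right (e i a)
    have h4 := dvd_sub h1 h2
    have : w₀ a - e j a = (v i - e i i) * e j a - (v j - e i j) * e i a := by
      simp [hw₀, HasLevel.koszul, hij.symm]
      ring
    rwa [this]
  have hww₀ : HasTv N v (w - w₀) := by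
    have hsum : w - w₀ = ∑ a, ∑ b, (w a * y b - e j a * e i b) • HasLevel.koszul v a b := by
      simp only [sub_smul, Finset.sum_sub_distrib]
      rw [HasLevel.sum_koszul hyv hwv]
      congr 1
      simp [Pi.single_apply, hw₀]
    rw [hsum]
    refine HasTv.sum_right fun a _ => HasTv.sum_right fun b _ => hN.koszul_mem h3 v a b ?_
    have := dvd_add ((dw a).mul_right (y b)) ((dy b).mul_left (e j a))
    have h4 : w a * y b - e j a * e i b = (w a - e j a) * y b + e j a * (y b - e i b) := by ring
    rwa [h4]
  have hvk : q ^ 2 ∣ v k := by simpa [hki] using dv k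
  have hw₀v' : w₀ ⬝ᵥ (v - v k • e k) = 0 := by
    rw [dotProduct_sub, hw₀v, dotProduct_smul, dotProduct_single_one, hw₀k, smul_zero, sub_zero]
  have hv'k : (v - v k • e k) k = 0 := by simp
  have hek : e k ⬝ᵥ (v - v k • e k) = 0 := by rw [single_one_dotProduct, hv'k]
  have hw₀e : w₀ ⬝ᵥ e k = 0 := by rw [dotProduct_single_one, hw₀k]
  have hki' : e k ⬝ᵥ e i = 0 := by simp [hki]
  have hjk' : e j ⬝ᵥ e k = 0 := by simp [hkj]
  have hkk : e k ⬝ᵥ e k = 1 := by simp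
  rw [mk_tv_right _ hw₀v hww₀, mk_tv_left _ hw₀v', ← tv_commutator hek hw₀e hkk,
    ← tv_commutator hki' hjk' hkk, map_commutatorElement, map_commutatorElement,
    mk_tv_left hek hki', mk_tv_right hw₀e hjk']
  · exact hN.row (by simp [hw₀k, hkj]) fun a => hq.trans (dw₀ a)
  · refine hN.column (by simp [hki]) fun a => ?_
    by_cases hak : a = k
    · subst hak; simp [hki]
    · simpa [hak] using hq.trans (dv a)
  · rw [sub_sub_cancel, HasTv.smul_left_iff]
    refine hN.row (by simp [hw₀k]) fun a => ?_
    exact (hq.trans hvk).mul_right _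

end Quotient

/-- A perfect group whose centre has finite index is finite. -/
theorem finite_of_perfect {G : Type*} [Group G] (hG : _root_.commutator G = ⊤)
    [(Subgroup.center G).FiniteIndex] : Finite G := by
  have hfin : Finite (commutatorSet G) := by
    let f : (G ⧸ Subgroup.center G) × (G ⧸ Subgroup.center G) → G :=
      fun p => ⁅p.1.out, p.2.out⁆
    refine (Set.finite_range f).subset ?_ |>.to_subtype
    rintro _ ⟨a, b, rfl⟩
    refine ⟨(a, b), ?_⟩
    obtain ⟨z, hz⟩ := QuotientGroup.mk_out_eq_mul (Subgroup.center G) a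
    obtain ⟨z', hz'⟩ := QuotientGroup.mk_out_eq_mul (Subgroup.center G) b
    have h1 := Subgroup.mem_center_iff.1 z.2
    have h2 := Subgroup.mem_center_iff.1 z'.2
    simp only [f, hz, hz', commutatorElement_def]
    rw [mul_inv_eq_iff_eq_mul, mul_inv_eq_iff_eq_mul]
    have e1 : a * z * (b * z') = a * b * (z * z') := by
      rw [mul_assoc, ← mul_assoc (z : G), ← h1 b]; simp only [mul_assoc]
    have e2 : b * z' * (a * z) = b * a * (z * z') := by
      rw [mul_assoc, ← mul_assoc (z' : G), ← h2 a, h2 z]; simp only [mul_assoc]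
    rw [mul_assoc _ _ (a * (z : G)), e1, e2]
    group
  have : Finite (_root_.commutator G) := inferInstance
  rw [hG] at this
  exact Finite.of_equiv _ Subgroup.topEquiv.toEquiv

variable (ι) in
/-- The principal congruence subgroup of level `Q`. -/
def congruence (Q : ℕ) : Subgroup (SpecialLinearGroup ι ℤ) :=
  (Matrix.SpecialLinearGroup.map (Int.castRingHom (ZMod Q))).ker

instance (Q : ℕ) [NeZero Q] : (congruence ι Q).FiniteIndex :=
  Subgroup.finiteIndex_ker _

theorem dvd_of_mem_congruence {Q : ℕ} {A : SpecialLinearGroup ι ℤ} (hA : A ∈ congruence ι Q)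
    (a b : ι) : (Q : ℤ) ∣ A a b - (1 : Matrix ι ι ℤ) a b := by
  have h := congrArg (fun B : SpecialLinearGroup ι (ZMod Q) => B a b) (MonoidHom.mem_ker.1 hA)
  have h' : ((A a b : ℤ) : ZMod Q) = (1 : Matrix ι ι (ZMod Q)) a b := h
  rw [← ZMod.intCast_zmod_eq_zero_iff_dvd, Int.cast_sub, h', one_apply, one_apply]
  split_ifs <;> simp

theorem finiteIndex_of_hasLevel (h3 : ∀ a b : ι, ∃ k, k ≠ a ∧ k ≠ b)
    (htop : ∀ K : Subgroup (SpecialLinearGroup ι ℤ), HasLevel K 1 → K = ⊤)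
    {H : Subgroup (SpecialLinearGroup ι ℤ)} {q : ℕ} (hq : q ≠ 0) (hH : HasLevel H q) :
    H.FiniteIndex := by
  set N := H.normalCore with hNdef
  have hN : HasLevel N ((q : ℤ) ^ 2) := hH.normalCore h3
  set π := QuotientGroup.mk' N with hπ
  have hπs : Function.Surjective π := QuotientGroup.mk'_surjective N
  have hd : ∀ i j : ι, i ≠ j → e j ⬝ᵥ e i = 0 := fun i j hij => by simp [hij]
  have : NeZero (q ^ 4) := ⟨pow_ne_zero _ hq⟩
  have hcast : ((q ^ 4 : ℕ) : ℤ) = ((q : ℤ) ^ 2) ^ 2 := by push_cast; ring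
  have hperf : _root_.commutator (SpecialLinearGroup ι ℤ) = ⊤ := by
    refine htop _ fun i j hij => ?_
    obtain ⟨k, hki, hkj⟩ := h3 i j
    rw [one_smul]
    refine ⟨hd i j hij, ?_⟩
    rw [← tv_commutator (hd i k hki.symm) (hd k j hkj) (by simp) (hd i j hij)]
    exact Subgroup.commutator_mem_commutator (Subgroup.mem_top _) (Subgroup.mem_top _)
  have hcentral : (congruence ι (q ^ 4)).map π ≤ Subgroup.center _ := by
    rintro _ ⟨A, hA, rfl⟩
    have hK : (Subgroup.centralizer {π A}).comap π = ⊤ := by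
      refine htop _ fun i j hij => ?_
      rw [one_smul]
      refine ⟨hd i j hij, ?_⟩
      rw [Subgroup.mem_comap, Subgroup.mem_centralizer_singleton_iff]
      have := mk_conj_elementary h3 hN (A := A) (fun a b => hcast ▸ dvd_of_mem_congruence hA a b)
        (fun a b => hcast ▸ dvd_of_mem_congruence (inv_mem hA) a b) hij (hd i j hij)
      rw [map_mul, map_mul, map_inv, mul_inv_eq_iff_eq_mul] at this
      exact this.symm
    rw [Subgroup.mem_center_iff]
    intro g
    obtain ⟨B, rfl⟩ := hπs g
    have hB : B ∈ (Subgroup.centralizer {π A}).comap π := hK ▸ Subgroup.mem_top B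
    exact Subgroup.mem_centralizer_singleton_iff.1 hB
  have : ((congruence ι (q ^ 4)).map π).FiniteIndex :=
    ⟨fun h => Subgroup.FiniteIndex.index_ne_zero (H := congruence ι (q ^ 4))
      (Nat.eq_zero_of_zero_dvd (h ▸ Subgroup.index_map_dvd _ hπs))⟩
  have : (Subgroup.center (SpecialLinearGroup ι ℤ ⧸ N)).FiniteIndex :=
    Subgroup.finiteIndex_of_le hcentral
  have : Finite (SpecialLinearGroup ι ℤ ⧸ N) := by
    refine finite_of_perfect ?_
    rw [_root_.commutator_def, ← Subgroup.map_top_of_surjective π hπs, ← Subgroup.map_commutator,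
      ← _root_.commutator_def, hperf]
  have : N.FiniteIndex := Subgroup.finiteIndex_of_finite_quotient
  exact Subgroup.finiteIndex_of_le H.normalCore_le

theorem tv_mul_apply {v : ι → ℤ} {k : ι} {c : ℤ} (h : (c • e k) ⬝ᵥ v = 0)
    (A : SpecialLinearGroup ι ℤ) (a b : ι) :
    (tv v (c • e k) h * A) a b = A a b + c * v a * A k b := by
  rw [Matrix.SpecialLinearGroup.coe_mul, coe_tv, add_mul, one_mul, vecMulVec_mul, smul_vecMul,
    single_one_vecMul, Matrix.add_apply, vecMulVec_apply, Pi.smul_apply, smul_eq_mul, row_apply]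
  ring

theorem mul_tv_apply {w : ι → ℤ} {k : ι} (h : w ⬝ᵥ e k = 0)
    (A : SpecialLinearGroup ι ℤ) (a b : ι) :
    (A * tv (e k) w h) a b = A a b + A a k * w b := by
  rw [Matrix.SpecialLinearGroup.coe_mul, coe_tv, mul_add, mul_one, mul_vecMulVec,
    mulVec_single_one, Matrix.add_apply, vecMulVec_apply, col_apply]

/-- The matrix `A` agrees with the identity in all rows and columns outside `T`. -/
def IsOneOutside (T : Finset ι) (A : SpecialLinearGroup ι ℤ) : Prop :=
  ∀ i ∉ T, ∀ j, A i j = (1 : Matrix ι ι ℤ) i j ∧ A j i = (1 : Matrix ι ι ℤ) j i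

theorem IsOneOutside.elementary_mul {T : Finset ι} {A : SpecialLinearGroup ι ℤ}
    (hA : IsOneOutside T A) {i j : ι} (hi : i ∈ T) (hj : j ∈ T) {c : ℤ}
    (h : (c • e j) ⬝ᵥ e i = 0) : IsOneOutside T (tv (e i) (c • e j) h * A) := by
  intro a ha b
  have hai : a ≠ i := fun h => ha (h ▸ hi)
  have haj : a ≠ j := fun h => ha (h ▸ hj)
  rw [tv_mul_apply, tv_mul_apply, (hA a ha b).1, (hA a ha b).2, (hA a ha j).2]
  simp [hai, haj.symm]

section Generation

variable {K : Subgroup (SpecialLinearGroup ι ℤ)} (hK : HasLevel K 1) {T : Finset ι} {k : ι}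
include hK

theorem mem_of_elementary_mul_mem {A : SpecialLinearGroup ι ℤ} {i j : ι} (hij : i ≠ j) (c : ℤ)
    (h : ∀ hd, tv (e i) (c • e j) hd * A ∈ K) : A ∈ K := by
  obtain ⟨hd, hm⟩ := hK.elementary hij (one_dvd c)
  exact (K.mul_mem_cancel_left hm).1 (h hd)

variable (hk : k ∈ T) (ih : ∀ A, IsOneOutside (T.erase k) A → A ∈ K)
include hk ih

theorem mem_of_apply_eq_one {A : SpecialLinearGroup ι ℤ} (hA : IsOneOutside T A)
    (hAk : A k k = 1) : A ∈ K := by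
  obtain ⟨hd, hm⟩ : HasTv K (fun a => e k a - A a k) ((1 : ℤ) • e k) := by
    rw [one_smul]
    exact hK.column (by simp [hAk]) fun _ => one_dvd _
  obtain ⟨hd', hm'⟩ : HasTv K (e k) (fun b => e k b - A k b) :=
    hK.row (by simp [hAk]) fun _ => one_dvd _
  rw [← K.mul_mem_cancel_left hm, ← K.mul_mem_cancel_right hm']
  refine ih _ fun i hi j => ?_
  simp only [mul_tv_apply, tv_mul_apply]
  by_cases hik : i = k
  · subst hik
    simp only [hAk, e_apply, one_apply_eq]
    constructor
    · rw [one_apply, one_apply]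
      simp only [eq_comm]
      ring
    · ring
  · have hiT : i ∉ T := fun h => hi (Finset.mem_erase.2 ⟨hik, h⟩)
    have h1 := (hA i hiT k).1
    have h2 := (hA i hiT k).2
    rw [one_apply_ne hik] at h1
    rw [one_apply_ne (Ne.symm hik)] at h2
    rw [(hA i hiT j).1, (hA i hiT j).2, h1, h2]
    simp [hik]

theorem mem_of_isUnit_of_ne {A : SpecialLinearGroup ι ℤ} (hA : IsOneOutside T A) {j : ι}
    (hj : j ∈ T) (hjk : j ≠ k) (hu : IsUnit (A j k)) : A ∈ K := by
  obtain ⟨u, hu⟩ := isUnit_iff_exists_inv'.1 hu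
  refine mem_of_elementary_mul_mem hK hjk.symm (u * (1 - A k k)) fun hd => ?_
  refine mem_of_apply_eq_one hK hk ih (hA.elementary_mul hk hj hd) ?_
  rw [tv_mul_apply, e_apply, one_apply_eq]
  linear_combination (1 - A k k) * hu

theorem mem_of_isUnit {A : SpecialLinearGroup ι ℤ} (hA : IsOneOutside T A) {i j : ι}
    (hi : i ∈ T) (hj : j ∈ T) (hjk : j ≠ k) (hu : IsUnit (A i k)) : A ∈ K := by
  by_cases hik : i = k
  · subst hik
    obtain ⟨u, hu⟩ := isUnit_iff_exists_inv'.1 hu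
    refine mem_of_elementary_mul_mem hK hjk (u * (1 - A j i)) fun hd => ?_
    refine mem_of_isUnit_of_ne hK hk ih (hA.elementary_mul hj hk hd) hj hjk ?_
    have : (tv (e j) ((u * (1 - A j i)) • e i) hd * A) j i = 1 := by
      rw [tv_mul_apply, e_apply, one_apply_eq]
      linear_combination (1 - A j i) * hu
    rw [this]
    exact isUnit_one
  · exact mem_of_isUnit_of_ne hK hk ih hA hi hik hu

theorem mem_of_isOneOutside : ∀ A : SpecialLinearGroup ι ℤ, IsOneOutside T A → A ∈ K := by
  suffices h : ∀ n : ℕ, ∀ A : SpecialLinearGroup ι ℤ, ∑ i ∈ T, (A i k).natAbs = n →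
      IsOneOutside T A → A ∈ K from fun A hA => h _ A rfl hA
  intro n
  induction n using Nat.strong_induction_on with
  | _ n ihn =>
  intro A hn hA
  by_cases hpair : ∃ i ∈ T, ∃ j ∈ T, i ≠ j ∧ A j k ≠ 0 ∧ (A j k).natAbs ≤ (A i k).natAbs
  · obtain ⟨i, hi, j, hj, hij, h0, hle⟩ := hpair
    refine mem_of_elementary_mul_mem hK hij (-(A i k / A j k)) fun hd => ?_
    refine ihn _ ?_ _ rfl (hA.elementary_mul hi hj hd)
    have hlt : ((tv (e i) (-(A i k / A j k) • e j) hd * A) i k).natAbs < (A i k).natAbs := by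
      have hmod : (tv (e i) (-(A i k / A j k) • e j) hd * A) i k = A i k % A j k := by
        rw [tv_mul_apply, e_apply, one_apply_eq, Int.emod_def]
        ring
      have h1 := Int.emod_nonneg (A i k) h0
      have h2 := Int.emod_lt_abs (A i k) h0
      rw [hmod]
      rw [Int.abs_eq_natAbs] at h2
      omega
    rw [← hn]
    refine Finset.sum_lt_sum (fun a _ => ?_) ⟨i, hi, hlt⟩
    by_cases hai : a = i
    · rw [hai]
      exact hlt.le
    · rw [tv_mul_apply]
      simp [hai]
  · have hzero : ∀ i ∈ T, A i k ≠ 0 → ∀ a, a ≠ i → A a k = 0 := by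
      intro i hi hik a hai
      by_cases haT : a ∈ T
      · by_contra hak
        rcases le_total (A i k).natAbs (A a k).natAbs with h | h
        · exact hpair ⟨a, haT, i, hi, hai, hik, h⟩
        · exact hpair ⟨i, hi, a, haT, hai.symm, hak, h⟩
      · have hak : a ≠ k := by rintro rfl; exact haT hk
        rw [(hA a haT k).1, one_apply_ne hak]
    have hone : ∑ a, A⁻¹ k a * A a k = 1 := by
      have : (A⁻¹ * A) k k = (1 : Matrix ι ι ℤ) k k := by
        rw [inv_mul_cancel, Matrix.SpecialLinearGroup.coe_one]
      rw [one_apply_eq, Matrix.SpecialLinearGroup.coe_mul, mul_apply] at this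
      exact this
    obtain ⟨i, hi, hik⟩ : ∃ i ∈ T, A i k ≠ 0 := by
      by_contra! hall
      have : ∑ a, A⁻¹ k a * A a k = 0 := Finset.sum_eq_zero fun a _ => by
        by_cases haT : a ∈ T
        · rw [hall a haT, mul_zero]
        · have hak : a ≠ k := by rintro rfl; exact haT hk
          rw [(hA a haT k).1, one_apply_ne hak, mul_zero]
      omega
    have hu : IsUnit (A i k) := by
      rw [Finset.sum_eq_single i (fun a _ hai => by rw [hzero i hi hik a hai, mul_zero])
        (by simp)] at hone
      exact isUnit_iff_exists_inv'.2 ⟨_, hone⟩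
    by_cases hT : ∃ j ∈ T, j ≠ k
    · obtain ⟨j, hj, hjk⟩ := hT
      exact mem_of_isUnit hK hk ih hA hi hj hjk hu
    · push Not at hT
      refine mem_of_apply_eq_one hK hk ih hA ?_
      have hdiag : (A : Matrix ι ι ℤ) = diagonal fun a => if a = k then A k k else 1 := by
        ext a b
        rw [diagonal_apply]
        by_cases hak : a = k
        · subst hak
          by_cases hab : a = b
          · subst hab; simp
          · rw [(hA b (fun h => hab (hT b h).symm) a).2, one_apply_ne hab, if_neg hab]
        · rw [(hA a (fun h => hak (hT a h)) b).1, one_apply, if_neg hak]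
      have hdet := A.det_coe
      rw [hdiag, det_diagonal] at hdet
      simpa using hdet

end Generation

/-- `SL(ι, ℤ)` is generated by elementary matrices. -/
theorem eq_top_of_hasLevel_one (K : Subgroup (SpecialLinearGroup ι ℤ)) (hK : HasLevel K 1) :
    K = ⊤ := by
  have h : ∀ T : Finset ι, ∀ A, IsOneOutside T A → A ∈ K := by
    intro T
    induction T using Finset.strongInduction with
    | H T ih =>
    rcases T.eq_empty_or_nonempty with rfl | ⟨k, hk⟩
    · intro A hA
      have : A = 1 := coe_injective (by ext i j; exact (hA i (by simp) j).1)
      exact this ▸ K.one_mem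
    · exact mem_of_isOneOutside hK hk (ih _ (Finset.erase_ssubset hk))
  exact K.eq_top_iff'.2 fun A => h Finset.univ A fun i hi => absurd (Finset.mem_univ i) hi

theorem tv_pow {v w : ι → ℤ} (h : w ⬝ᵥ v = 0) (m : ℕ) :
    tv v w h ^ m = tv v ((m : ℤ) • w) (by rw [smul_dotProduct, h, smul_zero]) := by
  induction m with
  | zero => exact coe_injective (by simp)
  | succ m ih =>
    rw [pow_succ, ih, tv_mul_tv_right]
    exact tv_congr _ _ (by rw [Nat.cast_succ, add_smul, one_smul])

theorem HasTv.conj {H : Subgroup (SpecialLinearGroup ι ℤ)} {v w : ι → ℤ} (h : HasTv H v w)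
    {g : SpecialLinearGroup ι ℤ} (hg : g ∈ H) :
    HasTv H ((g : Matrix ι ι ℤ) *ᵥ v)
      (w ᵥ* ((g⁻¹ : SpecialLinearGroup ι ℤ) : Matrix ι ι ℤ)) :=
  ⟨_, conj_tv g h.1 ▸ H.mul_mem (H.mul_mem hg h.2) (H.inv_mem hg)⟩

/-- A signed permutation matrix of determinant one for the permutation `σ`. -/
def signedPerm (σ : Equiv.Perm ι) (k : ι) : SpecialLinearGroup ι ℤ :=
  ⟨(diagonal (Function.update 1 k (Equiv.Perm.sign σ : ℤ))).submatrix σ.symm id, by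
    rw [det_permute, det_diagonal, Finset.prod_update_of_mem (Finset.mem_univ k),
      Equiv.Perm.sign_symm]
    simp [← Units.val_mul, Int.units_mul_self]⟩

theorem signedPerm_apply (σ : Equiv.Perm ι) (k a b : ι) :
    signedPerm σ k (σ a) b = Function.update (1 : ι → ℤ) k (Equiv.Perm.sign σ : ℤ) a * e a b := by
  change diagonal _ (σ.symm (σ a)) b = _
  rw [Equiv.symm_apply_apply, diagonal_apply, e_apply', one_apply, mul_ite, mul_one, mul_zero]

theorem exists_signedPerm_action (σ : Equiv.Perm ι) (k : ι) (i : ι) :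
    ∃ s : ℤ, s * s = 1 ∧ (signedPerm σ k : Matrix ι ι ℤ) *ᵥ e i = s • e (σ i) ∧
      e i ᵥ* (((signedPerm σ k)⁻¹ : SpecialLinearGroup ι ℤ) : Matrix ι ι ℤ) = s • e (σ i) := by
  have hs : Function.update (1 : ι → ℤ) k (Equiv.Perm.sign σ : ℤ) i *
      Function.update (1 : ι → ℤ) k (Equiv.Perm.sign σ : ℤ) i = 1 := by
    rw [Function.update_apply]
    split_ifs
    · rw [← Units.val_mul, Int.units_mul_self, Units.val_one]
    · simp
  refine ⟨_, hs, ?_, ?_⟩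
  · ext a
    obtain ⟨a, rfl⟩ := σ.surjective a
    rw [mulVec_single_one, col_apply, signedPerm_apply, Pi.smul_apply, smul_eq_mul, e_apply',
      e_apply, one_apply, one_apply]
    by_cases h : a = i
    · rw [h, if_pos rfl, if_pos rfl]
    · rw [if_neg h, if_neg (σ.injective.ne h), mul_zero, mul_zero]
  · have h : e i = (Function.update (1 : ι → ℤ) k (Equiv.Perm.sign σ : ℤ) i • e (σ i)) ᵥ*
        (signedPerm σ k : Matrix ι ι ℤ) := by
      ext b
      rw [smul_vecMul, single_one_vecMul, Pi.smul_apply, row_apply, signedPerm_apply, smul_eq_mul,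
        ← mul_assoc, hs, one_mul]
    conv_lhs => rw [h]
    rw [vecMul_vecMul, ← Matrix.SpecialLinearGroup.coe_mul, mul_inv_cancel,
      Matrix.SpecialLinearGroup.coe_one, vecMul_one]

theorem HasTv.conj_signedPerm {H : Subgroup (SpecialLinearGroup ι ℤ)} {σ : Equiv.Perm ι} {k : ι}
    (hg : signedPerm σ k ∈ H) {i j : ι} {c : ℤ} (h : HasTv H (e i) (c • e j)) :
    HasTv H (e (σ i)) (c • e (σ j)) := by
  obtain ⟨s, hs, h1, -⟩ := exists_signedPerm_action σ k i
  obtain ⟨t, ht, -, h2⟩ := exists_signedPerm_action σ k j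
  have h3 := h.conj hg
  rw [smul_vecMul, h1, h2, HasTv.smul_left_iff] at h3
  have h4 := h3.smul_right (s * t)
  rw [smul_smul, smul_smul, smul_smul] at h4
  convert h4 using 2
  linear_combination (-c * t * t) * hs - c * ht

section Cyclic

open scoped Fin.CommRing

variable {n : ℕ} [NeZero n] {H : Subgroup (SpecialLinearGroup (Fin n) ℤ)} {c : ℤ}

theorem hasTv_add_one (hg : signedPerm (Equiv.addRight 1) 0 ∈ H) (h : HasTv H (e 0) (c • e 1))
    (i : Fin n) : HasTv H (e i) (c • e (i + 1)) := by
  have key : ∀ k : ℕ, HasTv H (e (k : Fin n)) (c • e ((k : Fin n) + 1)) := by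
    intro k
    induction k with
    | zero => simpa only [Nat.cast_zero, zero_add] using h
    | succ k ih =>
      rw [Nat.cast_succ]
      exact ih.conj_signedPerm hg
  simpa only [Fin.cast_val_eq_self] using key i

theorem hasTv_add (h : ∀ i : Fin n, HasTv H (e i) (c • e (i + 1))) (i : Fin n) :
    ∀ d : ℕ, d + 1 < n → HasTv H (e i) (c ^ (d + 1) • e (i + (d + 1 : ℕ))) := by
  intro d
  induction d with
  | zero => intro _; simpa only [zero_add, pow_one, Nat.cast_one] using h i
  | succ d ih =>
    intro hd
    have hne : i ≠ i + (d + 1 + 1 : ℕ) := by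
      intro h
      have h0 : ((d + 1 + 1 : ℕ) : Fin n) = 0 := left_eq_add.1 h
      rw [Fin.natCast_eq_zero] at h0
      exact absurd (Nat.le_of_dvd (Nat.succ_pos _) h0) (by omega)
    have h1 := ih (by omega)
    have h2 := h (i + (d + 1 : ℕ))
    rw [add_assoc, ← Nat.cast_succ] at h2
    rw [← HasTv.smul_left_iff] at h1
    have h3 := h1.commutator h2 (by simp) (by
      rw [smul_dotProduct, dotProduct_smul, single_one_dotProduct, e_apply, one_apply_ne hne.symm,
        smul_zero, smul_zero])
    rwa [HasTv.smul_left_iff, smul_smul, ← pow_succ] at h3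

theorem hasLevel_of_hasTv_add_one (h : ∀ i : Fin n, HasTv H (e i) (c • e (i + 1))) :
    HasLevel H (c ^ n) := by
  intro i j hij
  obtain ⟨d, hd⟩ : ∃ d, (j - i).val = d + 1 :=
    Nat.exists_eq_succ_of_ne_zero fun h0 => hij (sub_eq_zero.1 (Fin.ext h0)).symm
  have hlt := (j - i).isLt
  have h1 := hasTv_add h i d (by omega)
  rw [← hd, Fin.cast_val_eq_self, add_sub_cancel] at h1
  have h2 := h1.smul_right (c ^ (n - (j - i).val))
  rwa [smul_smul, ← pow_add, Nat.sub_add_cancel hlt.le] at h2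

theorem finiteIndex_closure (hn : 3 ≤ n) (h : (e (1 : Fin n) : Fin n → ℤ) ⬝ᵥ e 0 = 0) {m : ℕ}
    (hm : m ≠ 0) :
    (Subgroup.closure {signedPerm (Equiv.addRight 1) 0, tv (e 0) (e 1) h ^ m}).FiniteIndex := by
  refine finiteIndex_of_hasLevel (q := m ^ n) (fun a b => ?_) eq_top_of_hasLevel_one
    (pow_ne_zero _ hm) ?_
  · obtain ⟨k, hk⟩ := Finset.exists_mem_notMem_of_card_lt_card
      (s := {a, b}) (t := (Finset.univ : Finset (Fin n)))
      (Finset.card_le_two.trans_lt (by rw [Finset.card_univ, Fintype.card_fin]; omega))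
    exact ⟨k, by simpa using hk⟩
  · rw [Nat.cast_pow]
    refine hasLevel_of_hasTv_add_one
      (hasTv_add_one (Subgroup.subset_closure (Set.mem_insert _ _))
        ⟨by rw [smul_dotProduct, h, smul_zero], ?_⟩)
    rw [← tv_pow h]
    exact Subgroup.subset_closure (Set.mem_insert_of_mem _ rfl)

end Cyclic

theorem exists_finiteIndex_closure {n : ℕ} (hn : 3 ≤ n) :
    ∃ g u : SpecialLinearGroup (Fin n) ℤ, ((u : Matrix (Fin n) (Fin n) ℤ) - 1) ^ n = 0 ∧
      ∀ m : ℕ, 1 ≤ m → (Subgroup.closure {g, u ^ m}).FiniteIndex := by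
  have : NeZero n := ⟨by omega⟩
  have : Fact (1 < n) := ⟨by omega⟩
  have h : (e (1 : Fin n) : Fin n → ℤ) ⬝ᵥ e 0 = 0 := by
    have h10 : (1 : Fin n) ≠ 0 := by
      rw [Ne, Fin.ext_iff, Fin.val_one', Fin.val_zero, Nat.mod_eq_of_lt (by omega)]
      exact one_ne_zero
    simp [h10]
  refine ⟨signedPerm (Equiv.addRight 1) 0, tv (e 0) (e 1) h, ?_,
    fun m hm => finiteIndex_closure hn h (by omega)⟩
  refine pow_eq_zero_of_le (show 2 ≤ n by omega) ?_
  rw [coe_tv, add_sub_cancel_left, pow_two, vecMulVec_mul_vecMulVec, h, zero_smul, vecMulVec_zero]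

end SLFiniteIndex

/-- **Theorem.** `SL(3,ℤ)` contains a finite-index subgroup generated by two elements;
more generally, for every `n ≥ 3`, `SL(n,ℤ)` contains elements `g` and a unipotent `u`
such that `⟨g, uᵐ⟩` has finite index in `SL(n,ℤ)` for every `m ≥ 1`. -/
theorem stmt19 :
    (∃ Λ : Subgroup (Matrix.SpecialLinearGroup (Fin 3) ℤ), Λ.FiniteIndex ∧
      ∃ a b : Matrix.SpecialLinearGroup (Fin 3) ℤ, Λ = Subgroup.closure {a, b}) ∧
    ∀ n : ℕ, 3 ≤ n → ∃ g u : Matrix.SpecialLinearGroup (Fin n) ℤ,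
      ((u : Matrix (Fin n) (Fin n) ℤ) - 1) ^ n = 0 ∧
      ∀ m : ℕ, 1 ≤ m → (Subgroup.closure {g, u ^ m}).FiniteIndex := by
  refine ⟨?_, fun n hn => SLFiniteIndex.exists_finiteIndex_closure hn⟩
  obtain ⟨g, u, -, h⟩ := SLFiniteIndex.exists_finiteIndex_closure le_rfl
  exact ⟨_, h 1 le_rfl, g, u ^ 1, rfl⟩
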